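/- Let h : ℝ → ℝ be bounded measurable, vanishing outside [0,1], with ∫_0^1 h(v) dv = 0, define g(x) = ∫_0^x h(v) dv, and let α : ℝ → ℝ be bounded measurable and vanishing outside [0,1]. Then there exists a constant C such that for every integer k ≥ 1, |∑_{r=−2k}^{2k} ψ_{g,h}(r/k) ψ_{α,α}(r/k)| ≤ C (that is, the Riemann sums of ψ_{g,h}·ψ_{α,α} on [−2,2] with mesh 1/k stay bounded without the factor k, since the integral of the odd function ψ_{g,h} times the even function ψ_{α,α} vanishes). -/

import Mathlib

open Filter Set MeasureTheory

/-- `ψ_{α,β}(x) = ∫_0^1 ∫_{x+u−1}^{x+u+1} α(u) β(v) dv du`. -/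
noncomputable def psi (α β : ℝ → ℝ) (x : ℝ) : ℝ :=
  ∫ u in (0:ℝ)..1, α u * ∫ v in (x + u - 1)..(x + u + 1), β v

lemma integrable_of_bounded_of_eq_zero_off_Icc {f : ℝ → ℝ} (hm : Measurable f)
    (hb : ∃ M : ℝ, ∀ x, |f x| ≤ M) (h0 : ∀ x, x ∉ Icc (0:ℝ) 1 → f x = 0) : Integrable f := by
  obtain ⟨M, hM⟩ := hb
  rw [← integrableOn_iff_integrable_of_support_subset (s := Icc (0:ℝ) 1)
    (fun x hx => by_contra fun h => hx (h0 x h))]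
  exact Measure.integrableOn_of_bounded (M := M) (by simp) hm.aestronglyMeasurable
    (Eventually.of_forall hM)

lemma intervalIntegral_eq_integral_of_eq_zero_off_Icc {f : ℝ → ℝ}
    (h0 : ∀ x, x ∉ Icc (0:ℝ) 1 → f x = 0) : ∫ u in (0:ℝ)..1, f u = ∫ u, f u := by
  rw [intervalIntegral.integral_of_le zero_le_one, ← integral_Icc_eq_integral_Ioc,
    setIntegral_eq_integral_of_forall_compl_eq_zero h0]

lemma psi_eq_integral {α : ℝ → ℝ} (β : ℝ → ℝ) (hα0 : ∀ x, x ∉ Icc (0:ℝ) 1 → α x = 0) (x : ℝ) :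
    psi α β x = ∫ u, α u * ∫ v in (x + u - 1)..(x + u + 1), β v :=
  intervalIntegral_eq_integral_of_eq_zero_off_Icc fun u hu => by simp [hα0 u hu]

/-- Exchanging the two functions reflects `psi`. -/
lemma psi_neg {α β : ℝ → ℝ} (hα : Integrable α) (hβ : Integrable β)
    (hα0 : ∀ x, x ∉ Icc (0:ℝ) 1 → α x = 0) (hβ0 : ∀ x, x ∉ Icc (0:ℝ) 1 → β x = 0) (x : ℝ) :
    psi β α (-x) = psi α β x := by
  rw [psi_eq_integral _ hα0, psi_eq_integral _ hβ0]
  let S : Set (ℝ × ℝ) := {p | x + p.1 - 1 < p.2 ∧ p.2 ≤ x + p.1 + 1}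
  have hS : MeasurableSet S := by
    have h₁ : MeasurableSet {p : ℝ × ℝ | x + p.1 - 1 < p.2} :=
      measurableSet_lt (by fun_prop) (by fun_prop)
    have h₂ : MeasurableSet {p : ℝ × ℝ | p.2 ≤ x + p.1 + 1} :=
      measurableSet_le (by fun_prop) (by fun_prop)
    exact h₁.inter h₂
  let F : ℝ → ℝ → ℝ := fun u v => S.indicator (fun p => α p.1 * β p.2) (u, v)
  have hF : Integrable (Function.uncurry F) (volume.prod volume) :=
    (hα.mul_prod hβ).indicator hS
  have hleft : ∀ u, (α u * ∫ v in (x + u - 1)..(x + u + 1), β v) = ∫ v, F u v := by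
    intro u
    rw [intervalIntegral.integral_of_le (by linarith), ← integral_indicator measurableSet_Ioc,
      ← integral_const_mul]
    refine integral_congr_ae (Eventually.of_forall fun v => ?_)
    simp only [F, S, indicator, mem_Ioc, mem_ofPred_eq, mul_ite, mul_zero]
  have hright : ∀ v, (β v * ∫ u in (-x + v - 1)..(-x + v + 1), α u) = ∫ u, F u v := by
    intro v
    rw [intervalIntegral.integral_of_le (by linarith), ← integral_Ico_eq_integral_Ioc,
      ← integral_indicator measurableSet_Ico, ← integral_const_mul]
    refine integral_congr_ae (Eventually.of_forall fun u => ?_)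
    have hiff : u ∈ Ico (-x + v - 1) (-x + v + 1) ↔ (u, v) ∈ S := by
      simp only [S, mem_Ico, mem_ofPred_eq]
      constructor <;> rintro ⟨h₁, h₂⟩ <;> constructor <;> linarith
    simp only [F, indicator, hiff, mul_ite, mul_zero, mul_comm]
  simp only [hleft, hright]
  exact (integral_integral_swap hF).symm

/-- If `g` is a compactly supported primitive of `h`, then `psi g h` is odd. -/
lemma psi_primitive_neg {h g : ℝ → ℝ} (hh : Integrable h)
    (hh0 : ∀ x, x ∉ Icc (0:ℝ) 1 → h x = 0) (hhint : (∫ v in (0:ℝ)..1, h v) = 0)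
    (hg : ∀ x : ℝ, g x = ∫ v in (0:ℝ)..x, h v) (x : ℝ) :
    psi g h (-x) = -psi g h x := by
  have hgc : Continuous g := by
    rw [funext hg]
    exact intervalIntegral.continuous_primitive (fun _ _ => hh.intervalIntegrable) 0
  have hg0 : ∀ y, y ∉ Icc (0:ℝ) 1 → g y = 0 := by
    intro y hy
    rw [hg]
    rcases lt_or_ge y 0 with hy0 | hy0
    · rw [intervalIntegral.integral_symm, intervalIntegral.integral_of_le hy0.le,
        ← integral_Ico_eq_integral_Ioc, neg_eq_zero]
      exact setIntegral_eq_zero_of_forall_eq_zero fun v hv => hh0 v fun hv' => by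
        linarith [hv.2, hv'.1]
    · have hy1 : 1 < y := by
        by_contra hle
        exact hy ⟨hy0, not_lt.mp hle⟩
      rw [← intervalIntegral.integral_add_adjacent_intervals (b := 1) hh.intervalIntegrable
        hh.intervalIntegrable, hhint, zero_add, intervalIntegral.integral_of_le hy1.le]
      exact setIntegral_eq_zero_of_forall_eq_zero fun v hv => hh0 v fun hv' => by
        linarith [hv.1, hv'.2]
  have hgs : HasCompactSupport g := HasCompactSupport.intro isCompact_Icc hg0
  have hint : ∀ t, Integrable fun u => g u * g (u + t) := fun t =>
    (by fun_prop : Continuous fun u => g u * g (u + t)).integrable_of_hasCompactSupport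
      hgs.mul_right
  have heven : ∀ t, ∫ u, g u * g (u + -t) = ∫ u, g u * g (u + t) := by
    intro t
    rw [← integral_add_right_eq_self (fun u => g u * g (u + -t)) t]
    simp only [add_neg_cancel_right, mul_comm]
  have key : ∀ y, psi g h y = (∫ u, g u * g (u + (y + 1))) - ∫ u, g u * g (u + (y - 1)) := by
    intro y
    rw [psi_eq_integral _ hg0, ← integral_sub (hint _) (hint _)]
    refine integral_congr_ae (Eventually.of_forall fun u => ?_)
    have hdiff : ∫ v in (y + u - 1)..(y + u + 1), h v = g (u + (y + 1)) - g (u + (y - 1)) := by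
      rw [hg, hg, intervalIntegral.integral_interval_sub_left hh.intervalIntegrable
        hh.intervalIntegrable]
      congr 1 <;> ring
    simp only [hdiff, mul_sub]
  rw [key, key, show -x + 1 = -(x - 1) by ring, show -x - 1 = -(x + 1) by ring, heven, heven,
    neg_sub]

/-- with `h` bounded measurable vanishing outside `[0,1]`, `∫_0^1 h = 0`,
`g(x) = ∫_0^x h(v) dv`, and `α` bounded measurable vanishing outside `[0,1]`, there is a
constant `C` such that for every `k ≥ 1`,
`|∑_{r=−2k}^{2k} ψ_{g,h}(r/k) ψ_{α,α}(r/k)| ≤ C`. -/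
theorem stmt14 (h g α : ℝ → ℝ)
    (hhm : Measurable h) (hhb : ∃ M : ℝ, ∀ x, |h x| ≤ M)
    (hh0 : ∀ x, x ∉ Set.Icc (0:ℝ) 1 → h x = 0)
    (hhint : (∫ v in (0:ℝ)..1, h v) = 0)
    (hg : ∀ x : ℝ, g x = ∫ v in (0:ℝ)..x, h v)
    (hαm : Measurable α) (hαb : ∃ M : ℝ, ∀ x, |α x| ≤ M)
    (hα0 : ∀ x, x ∉ Set.Icc (0:ℝ) 1 → α x = 0) :
    ∃ C : ℝ, ∀ k : ℕ, 1 ≤ k →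
      |∑ r ∈ Finset.Icc (-(2 * (k : ℤ))) (2 * (k : ℤ)),
          psi g h ((r : ℝ) / k) * psi α α ((r : ℝ) / k)| ≤ C := by
  refine ⟨0, fun k _ => ?_⟩
  have hh := integrable_of_bounded_of_eq_zero_off_Icc hhm hhb hh0
  have hα := integrable_of_bounded_of_eq_zero_off_Icc hαm hαb hα0
  rw [abs_nonpos_iff, ← self_eq_neg, ← Finset.sum_neg_distrib]
  refine Finset.sum_nbij' (fun r => -r) (fun r => -r) ?_ ?_ ?_ ?_ ?_
  · intro r hr
    simp only [Finset.mem_Icc] at hr ⊢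
    lia
  · intro r hr
    simp only [Finset.mem_Icc] at hr ⊢
    lia
  · simp
  · simp
  · intro r _
    rw [Int.cast_neg, neg_div, psi_primitive_neg hh hh0 hhint hg, psi_neg hα hα hα0 hα0]
    ring
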